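/- (Orthogonality of the Romanovski polynomials.) Let b < 0 and b + c > 0, and let m ≠ n be nonnegative integers with m < −b and n < −b. Then ∫₀^∞ p_m(x) p_n(x) x^{b+c−1}(1+x)^{b−c} dx = 0, the integral being absolutely convergent. -/

import Mathlib

open MeasureTheory Real Set

noncomputable section

/-- The `m`-th Romanovski polynomial
`p_m(x) = ₂F₁(-m, 2b+m; b+c; -x)
        = ∑_{k=0}^m ((-m)_k (2b+m)_k / ((b+c)_k k!)) (-x)^k`. -/
def romanovski (b c : ℝ) (m : ℕ) (x : ℝ) : ℝ :=
  ∑ k ∈ Finset.range (m + 1),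
    (ascPochhammer ℝ k).eval (-(m : ℝ)) * (ascPochhammer ℝ k).eval (2 * b + m) /
      ((ascPochhammer ℝ k).eval (b + c) * (k.factorial : ℝ)) * (-x) ^ k

open Polynomial Filter Asymptotics Topology

/-- The coefficient of `x ^ k` in the `m`-th Romanovski polynomial. -/
def romanovskiCoeff (b c : ℝ) (m k : ℕ) : ℝ :=
  (ascPochhammer ℝ k).eval (-(m : ℝ)) * (ascPochhammer ℝ k).eval (2 * b + m) /
    ((ascPochhammer ℝ k).eval (b + c) * (k.factorial : ℝ)) * (-1) ^ k

/-- The Romanovski polynomial as an element of `ℝ[X]`. -/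
def romanovskiPoly (b c : ℝ) (m : ℕ) : ℝ[X] :=
  ∑ k ∈ Finset.range (m + 1), monomial k (romanovskiCoeff b c m k)

lemma eval_romanovskiPoly (b c : ℝ) (m : ℕ) (x : ℝ) :
    (romanovskiPoly b c m).eval x = romanovski b c m x := by
  simp only [romanovskiPoly, romanovski, romanovskiCoeff, eval_finsetSum, eval_monomial]
  refine Finset.sum_congr rfl fun k _ => ?_
  rw [neg_pow x, mul_assoc]

lemma coeff_romanovskiPoly (b c : ℝ) (m k : ℕ) :
    (romanovskiPoly b c m).coeff k = romanovskiCoeff b c m k := by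
  simp only [romanovskiPoly, finsetSum_coeff, coeff_monomial, Finset.sum_ite_eq',
    Finset.mem_range]
  split_ifs with h
  · rfl
  · simp [romanovskiCoeff, ascPochhammer_eval_neg_coe_nat_of_lt (show m < k by omega)]

lemma natDegree_romanovskiPoly_le (b c : ℝ) (m : ℕ) : (romanovskiPoly b c m).natDegree ≤ m :=
  natDegree_sum_le_of_forall_le _ _ fun _ hk =>
    (natDegree_monomial_le _).trans (Nat.lt_succ_iff.1 (Finset.mem_range.1 hk))

lemma romanovskiCoeff_succ {b c : ℝ} (hbc : 0 < b + c) (m k : ℕ) :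
    (k + 1) * (k + (b + c)) * romanovskiCoeff b c m (k + 1) =
      (m - k) * (m + k + 2 * b) * romanovskiCoeff b c m k := by
  have h1 := (ascPochhammer_pos k (b + c) hbc).ne'
  have h2 : b + c + (k : ℝ) ≠ 0 := by positivity
  have h3 : (k.factorial : ℝ) ≠ 0 := by positivity
  have h4 : (k : ℝ) + 1 ≠ 0 := by positivity
  simp only [romanovskiCoeff, ascPochhammer_succ_eval, Nat.factorial_succ, Nat.cast_mul,
    Nat.cast_succ, pow_succ]
  field_simp
  ring

/-- The hypergeometric differential equation satisfied by the Romanovski polynomials. -/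
lemma romanovskiPoly_ode {b c : ℝ} (hbc : 0 < b + c) (m : ℕ) :
    X * (1 + X) * derivative (derivative (romanovskiPoly b c m)) +
        (C (b + c) + C (2 * b + 1) * X) * derivative (romanovskiPoly b c m) =
      C (m * (m + 2 * b)) * romanovskiPoly b c m := by
  have hrec (k : ℕ) := romanovskiCoeff_succ hbc m k
  simp only [← coeff_romanovskiPoly] at hrec
  set p := romanovskiPoly b c m
  have e : X * (1 + X) * derivative (derivative p) +
        (C (b + c) + C (2 * b + 1) * X) * derivative p =
      X * derivative (derivative p) + X * (X * derivative (derivative p)) +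
        C (b + c) * derivative p + C (2 * b + 1) * (X * derivative p) := by ring
  rw [e]
  ext k
  replace hrec := hrec k
  simp only [coeff_add, coeff_C_mul]
  rcases k with _ | _ | k
  all_goals
    simp [coeff_derivative] at hrec ⊢
    linear_combination hrec

lemma natDegree_X_mul_derivative_le (p : ℝ[X]) : (X * derivative p).natDegree ≤ p.natDegree := by
  rcases Nat.eq_zero_or_pos p.natDegree with h | h
  · simp [derivative_of_natDegree_zero h]
  · refine natDegree_mul_le.trans ?_
    have := natDegree_derivative_le p
    rw [natDegree_X]
    omega

lemma isBigO_eval_mul_one_add_rpow {q : ℝ[X]} {N : ℕ} (hq : q.natDegree ≤ N) (E : ℝ) :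
    (fun x : ℝ => q.eval x * (1 + x) ^ E) =O[atTop] fun x : ℝ => x ^ (N + E) := by
  have h1 : (fun x : ℝ => q.eval x) =O[atTop] fun x : ℝ => x ^ N := by
    have := Polynomial.isBigO_atTop_of_degree_le q (X ^ N : ℝ[X])
      (by rw [degree_X_pow]; exact natDegree_le_iff_degree_le.1 hq)
    simpa using this
  have h2 : (fun x : ℝ => (1 + x) ^ E) =O[atTop] fun x : ℝ => x ^ E := by
    refine (IsTheta.rpow ?_ ?_ ?_).isBigO
    · filter_upwards [eventually_ge_atTop 0] with x hx
      simp only [Pi.zero_apply]; positivity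
    · exact eventually_ge_atTop 0
    · have h : (fun _ : ℝ => (1 : ℝ)) =o[atTop] fun x : ℝ => x := isLittleO_const_id_atTop 1
      have h' := (IsEquivalent.refl.add_isLittleO h).isTheta
      rwa [add_comm] at h'
  refine (h1.mul h2).congr' EventuallyEq.rfl ?_
  filter_upwards [eventually_gt_atTop 0] with x hx
  rw [rpow_add hx, rpow_natCast]

/-- A polynomial is integrable on `(0, ∞)` against `x ^ (s - 1) * (1 + x) ^ E` as soon as
`s > 0` and the integrand decays faster than `x⁻¹`. -/
lemma integrableOn_eval_mul_weight {q : ℝ[X]} {N : ℕ} (hq : q.natDegree ≤ N) {s E : ℝ}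
    (hs : 0 < s) (hN : N + s + E < 0) :
    IntegrableOn (fun x : ℝ => q.eval x * (x ^ (s - 1) * (1 + x) ^ E)) (Ioi 0) := by
  have hcont : ContinuousOn (fun x : ℝ => q.eval x * (1 + x) ^ E) (Ici 0) := by
    refine q.continuousOn.mul (ContinuousOn.rpow_const (by fun_prop) fun x hx => Or.inl ?_)
    have : (0 : ℝ) ≤ x := hx
    positivity
  have h := mellin_convergent_of_isBigO_scalar (a := -(N + E)) (b := 0) (s := s)
    ((hcont.mono Ioi_subset_Ici_self).locallyIntegrableOn measurableSet_Ioi)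
    (by simpa using isBigO_eval_mul_one_add_rpow hq E) (by linarith)
    (by
      simp only [neg_zero, rpow_zero]
      exact ((hcont 0 self_mem_Ici).mono Ioi_subset_Ici_self).tendsto.isBigO_one ℝ) hs
  refine h.congr_fun (fun x _ => ?_) measurableSet_Ioi
  ring

/-- If two polynomials satisfy the same hypergeometric equation with spectral parameters `μ`
and `ν`, the weighted Wronskian is a primitive of `(μ - ν) * p * q` times the weight. -/
lemma hasDerivAt_weighted_wronskian {p q : ℝ[X]} {s E μ ν : ℝ}
    (hp : X * (1 + X) * derivative (derivative p) + (C s + C (s + E + 1) * X) * derivative p =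
      C μ * p)
    (hq : X * (1 + X) * derivative (derivative q) + (C s + C (s + E + 1) * X) * derivative q =
      C ν * q) {x : ℝ} (hx : 0 < x) :
    HasDerivAt
      (fun x : ℝ => (derivative p * q - p * derivative q).eval x * (x ^ s * (1 + x) ^ (E + 1)))
      ((μ - ν) * (p.eval x * q.eval x * (x ^ (s - 1) * (1 + x) ^ E))) x := by
  have hx1 : 0 < 1 + x := by positivity
  have h1 : HasDerivAt (fun x : ℝ => x ^ s) (s * x ^ (s - 1)) x :=
    hasDerivAt_rpow_const (Or.inl hx.ne')
  have h2 : HasDerivAt (fun x : ℝ => (1 + x) ^ (E + 1)) ((E + 1) * (1 + x) ^ E) x := by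
    simpa using ((hasDerivAt_id x).const_add 1).rpow_const (p := E + 1) (Or.inl hx1.ne')
  have h := (Polynomial.hasDerivAt (derivative p * q - p * derivative q) x).mul (h1.mul h2)
  refine h.congr_deriv ?_
  have hp' := congrArg (eval x) hp
  have hq' := congrArg (eval x) hq
  have e1 : x ^ s = x ^ (s - 1) * x := by
    rw [← rpow_add_one hx.ne']; simp
  have e2 : (1 + x) ^ (E + 1) = (1 + x) ^ E * (1 + x) := rpow_add_one hx1.ne' E
  simp only [eval_add, eval_mul, eval_X, eval_C, eval_one] at hp' hq'
  simp only [derivative_sub, derivative_mul, eval_sub, eval_add, eval_mul, Pi.mul_apply, e1, e2]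
  linear_combination (x ^ (s - 1) * (1 + x) ^ E) * (q.eval x * hp' - p.eval x * hq')

lemma tendsto_eval_mul_weight_atTop {w : ℝ[X]} {N : ℕ} (hw : (X * w).natDegree ≤ N) {s E : ℝ}
    (hN : N + s + E < 0) :
    Tendsto (fun x : ℝ => w.eval x * (x ^ s * (1 + x) ^ (E + 1))) atTop (𝓝 0) := by
  have h := (isBigO_refl (fun x : ℝ => x ^ (s - 1)) atTop).mul
    (isBigO_eval_mul_one_add_rpow hw (E + 1))
  have ht := tendsto_rpow_neg_atTop (y := -(N + s + E)) (by linarith)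
  refine IsBigO.trans_tendsto (h.congr' ?_ ?_) ht
  · filter_upwards [eventually_gt_atTop 0] with x hx
    have e1 : x ^ s = x ^ (s - 1) * x := by
      rw [← rpow_add_one hx.ne']; simp
    simp only [eval_mul, eval_X, e1]
    ring
  · filter_upwards [eventually_gt_atTop 0] with x hx
    rw [← rpow_add hx]
    congr 1
    ring

/-- **Orthogonality of the Romanovski polynomials:** for `b < 0 < b + c` and
distinct nonnegative integers `m, n < -b`,
`∫₀^∞ p_m(x) p_n(x) x^(b+c-1)(1+x)^(b-c) dx = 0`, the integral converging
absolutely. -/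
theorem romanovski_orthogonal (b c : ℝ) (hb : b < 0) (hbc : 0 < b + c)
    (m n : ℕ) (hmn : m ≠ n) (hm : (m : ℝ) < -b) (hn : (n : ℝ) < -b) :
    IntegrableOn
      (fun x : ℝ =>
        romanovski b c m x * romanovski b c n x * (x ^ (b + c - 1) * (1 + x) ^ (b - c)))
      (Ioi (0 : ℝ)) ∧
    (∫ x in Ioi (0 : ℝ),
        romanovski b c m x * romanovski b c n x *
          (x ^ (b + c - 1) * (1 + x) ^ (b - c))) = 0 := by
  simp only [← eval_romanovskiPoly]
  have hpm := romanovskiPoly_ode hbc m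
  have hpn := romanovskiPoly_ode hbc n
  have hdm := natDegree_romanovskiPoly_le b c m
  have hdn := natDegree_romanovskiPoly_le b c n
  set p := romanovskiPoly b c m
  set q := romanovskiPoly b c n
  rw [show 2 * b + 1 = b + c + (b - c) + 1 by ring] at hpm hpn
  have hN : ((m + n : ℕ) : ℝ) + (b + c) + (b - c) < 0 := by
    push_cast
    linarith
  have hint : IntegrableOn
      (fun x : ℝ => p.eval x * q.eval x * (x ^ (b + c - 1) * (1 + x) ^ (b - c))) (Ioi 0) := by
    simpa only [eval_mul] using
      integrableOn_eval_mul_weight (natDegree_mul_le_of_le hdm hdn) hbc hN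
  refine ⟨hint, ?_⟩
  have hw : (X * (derivative p * q - p * derivative q)).natDegree ≤ m + n := by
    rw [show X * (derivative p * q - p * derivative q) =
      X * derivative p * q - p * (X * derivative q) by ring]
    exact (natDegree_sub_le_of_le
      (natDegree_mul_le_of_le ((natDegree_X_mul_derivative_le p).trans hdm) hdn)
      (natDegree_mul_le_of_le hdm ((natDegree_X_mul_derivative_le q).trans hdn))).trans
      (max_self _).le
  have hcont : ContinuousWithinAt (fun x : ℝ =>
      (derivative p * q - p * derivative q).eval x * (x ^ (b + c) * (1 + x) ^ (b - c + 1)))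
      (Ici 0) 0 := by
    exact ((Polynomial.continuous _).continuousAt.mul
      ((continuousAt_rpow_const 0 (b + c) (Or.inr hbc.le)).mul
        (ContinuousAt.rpow_const (by fun_prop) (Or.inl (by norm_num))))).continuousWithinAt
  have key := integral_Ioi_of_hasDerivAt_of_tendsto hcont
    (fun x hx => hasDerivAt_weighted_wronskian hpm hpn hx) (hint.const_mul _)
    (tendsto_eval_mul_weight_atTop hw hN)
  rw [integral_const_mul, zero_rpow hbc.ne', zero_mul, mul_zero, sub_zero] at key
  refine (mul_eq_zero.1 key).resolve_left ?_
  rw [show (m : ℝ) * (m + 2 * b) - n * (n + 2 * b) = (m - n) * (m + n + 2 * b) by ring]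
  exact mul_ne_zero (sub_ne_zero.2 (Nat.cast_injective.ne hmn)) (by linarith)

end
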